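/- Let G and H be ancestral graphs on vertex set [p] and let 𝓘 be a multiset of intervention targets such that no selection adjacent node of G or of H is intervened on by any target in 𝓘. Then G and H are 𝓘-Markov equivalent if and only if \bar{G}^𝓘 and \bar{H}^𝓘 are Markov equivalent maximal ancestral graphs. -/

import Mathlib

/-
Common formalization infrastructure for loopless mixed graphs (LMGs),
m-separation, Markov equivalence, interventional graphs, ribbons,
ancestral graphs, colliders with order, and the head/tail factorization
machinery of acyclic directed mixed graphs (ADMGs), following
"Distributional Invariances and Interventional Markov Equivalence
for Mixed Graph Models" (Solus).
-/

open Relation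

/-- An endpoint mark of an edge in a mixed graph: either a tail or an arrowhead. -/
inductive Mark : Type
  | tail : Mark
  | arrow : Mark
  deriving DecidableEq

/-- A mixed graph on a vertex type `V`: `edge a b m₁ m₂` means there is an edge
between `a` and `b` carrying mark `m₁` at `a` and mark `m₂` at `b`.
Undirected edges are `(tail, tail)`, directed `a → b` is `(tail, arrow)`,
and bidirected is `(arrow, arrow)`. -/
structure MixedGraph (V : Type) : Type where
  edge : V → V → Mark → Mark → Prop

namespace MixedGraph

variable {V : Type}

/-- A loopless mixed graph: edges are symmetric (with endpoint marks swapped) and no loops. -/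
def IsLMG (G : MixedGraph V) : Prop :=
  (∀ a b m₁ m₂, G.edge a b m₁ m₂ → G.edge b a m₂ m₁) ∧ ∀ a m₁ m₂, ¬ G.edge a a m₁ m₂

/-- Two vertices are adjacent if there is some edge between them. -/
def adj (G : MixedGraph V) (a b : V) : Prop := ∃ m₁ m₂, G.edge a b m₁ m₂

/-- A simple mixed graph: at most one edge between any two nodes. -/
def Simple (G : MixedGraph V) : Prop :=
  ∀ a b m₁ m₂ n₁ n₂, G.edge a b m₁ m₂ → G.edge a b n₁ n₂ → m₁ = n₁ ∧ m₂ = n₂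

/-- A directed edge `a → b`. -/
def dirEdge (G : MixedGraph V) (a b : V) : Prop := G.edge a b Mark.tail Mark.arrow

/-- A bidirected edge `a ↔ b`. -/
def bidirEdge (G : MixedGraph V) (a b : V) : Prop := G.edge a b Mark.arrow Mark.arrow

/-- An undirected edge `a − b`. -/
def undirEdge (G : MixedGraph V) (a b : V) : Prop := G.edge a b Mark.tail Mark.tail

/-- `a` is an ancestor of `b` (reflexively: there is a directed path, possibly trivial). -/
def ancestor (G : MixedGraph V) (a b : V) : Prop := ReflTransGen G.dirEdge a b

/-- A node is selection adjacent when it is an endpoint of an undirected edge. -/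
def selectionAdjacent (G : MixedGraph V) (a : V) : Prop := ∃ b, G.undirEdge a b ∨ G.undirEdge b a

/-- An ancestral graph: an LMG with no directed cycles, no bidirected edge with a
(nontrivial) directed path between its endpoints, and no arrowhead pointing into a
selection adjacent node. -/
def IsAncestral (G : MixedGraph V) : Prop :=
  G.IsLMG ∧ (∀ a, ¬ TransGen G.dirEdge a a) ∧
    (∀ a b, G.bidirEdge a b → ¬ TransGen G.dirEdge a b ∧ ¬ TransGen G.dirEdge b a) ∧
    ∀ a, G.selectionAdjacent a → ∀ b m, ¬ G.edge b a m Mark.arrow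

/-- An acyclic directed mixed graph: only directed and bidirected edges, no directed cycles. -/
def IsADMG (G : MixedGraph V) : Prop :=
  G.IsLMG ∧ (∀ a b m₁ m₂, G.edge a b m₁ m₂ → ¬ (m₁ = Mark.tail ∧ m₂ = Mark.tail)) ∧
    ∀ a, ¬ TransGen G.dirEdge a a

/-- A directed acyclic graph: only directed edges, and no directed cycles. -/
def IsDAG (G : MixedGraph V) : Prop :=
  G.IsLMG ∧
    (∀ a b m₁ m₂, G.edge a b m₁ m₂ →
      (m₁ = Mark.tail ∧ m₂ = Mark.arrow) ∨ (m₁ = Mark.arrow ∧ m₂ = Mark.tail)) ∧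
    ∀ a, ¬ TransGen G.dirEdge a a

/-- A directed ancestral graph: an ancestral graph with no undirected edges. -/
def IsDirectedAncestral (G : MixedGraph V) : Prop := G.IsAncestral ∧ ∀ a b, ¬ G.undirEdge a b

/-- A walk in a mixed graph `G`, recording at each step the pair of endpoint marks used. -/
structure MWalk (G : MixedGraph V) : Type where
  len : ℕ
  vtx : ℕ → V
  mk₁ : ℕ → Mark
  mk₂ : ℕ → Mark
  isEdge : ∀ i, i < len → G.edge (vtx i) (vtx (i + 1)) (mk₁ i) (mk₂ i)

namespace MWalk

variable {G : MixedGraph V}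

/-- The interior vertex at position `i` is a collider on the walk. -/
def colliderAt (w : MWalk G) (i : ℕ) : Prop :=
  0 < i ∧ i < w.len ∧ w.mk₂ (i - 1) = Mark.arrow ∧ w.mk₁ i = Mark.arrow

/-- The walk is a path: all of its vertices are pairwise distinct. -/
def IsPath (w : MWalk G) : Prop :=
  ∀ i j, i ≤ w.len → j ≤ w.len → w.vtx i = w.vtx j → i = j

/-- The walk is m-connecting given `C`: all colliders are in `C` or ancestors of `C`,
all non-collider vertices are outside of `C`. -/
def mConnecting (w : MWalk G) (C : Set V) : Prop :=
  (∀ i, w.colliderAt i → ∃ c ∈ C, G.ancestor (w.vtx i) c) ∧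
    ∀ i, i ≤ w.len → ¬ w.colliderAt i → w.vtx i ∉ C

end MWalk

/-- There is an m-connecting path between `a` and `b` given `C`. -/
def mConnected (G : MixedGraph V) (a b : V) (C : Set V) : Prop :=
  ∃ w : MWalk G, w.IsPath ∧ w.vtx 0 = a ∧ w.vtx w.len = b ∧ w.mConnecting C

/-- `C` m-separates `A` and `B` in `G`. -/
def mSep (G : MixedGraph V) (A B C : Set V) : Prop := ∀ a ∈ A, ∀ b ∈ B, ¬ G.mConnected a b C

/-- The (formal) independence model `J(G)`: triples `⟨A,B∣C⟩` with `A,B` disjoint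
and m-separated given `C`. -/
def indep (G : MixedGraph V) (A B C : Set V) : Prop := Disjoint A B ∧ G.mSep A B C

/-- Markov equivalence: equal independence models. -/
def MarkovEquiv (G H : MixedGraph V) : Prop := ∀ A B C : Set V, G.indep A B C ↔ H.indep A B C

/-- The result of adding a single edge (with marks `m₁, m₂`) between `a` and `b`. -/
def addEdge (G : MixedGraph V) (a b : V) (m₁ m₂ : Mark) : MixedGraph V where
  edge x y n₁ n₂ := G.edge x y n₁ n₂ ∨ (x = a ∧ y = b ∧ n₁ = m₁ ∧ n₂ = m₂) ∨
    (x = b ∧ y = a ∧ n₁ = m₂ ∧ n₂ = m₁)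

/-- A mixed graph is maximal if adding any edge between nonadjacent vertices changes
its independence model. -/
def IsMaximal (G : MixedGraph V) : Prop :=
  ∀ a b, a ≠ b → ¬ G.adj a b → ∀ m₁ m₂, ¬ MarkovEquiv (G.addEdge a b m₁ m₂) G

/-- `G` is an (edge-)subgraph of `K` on the same vertex set. -/
def Subgraph (G K : MixedGraph V) : Prop := ∀ a b m₁ m₂, G.edge a b m₁ m₂ → K.edge a b m₁ m₂

/-- `K` is the maximal ancestral graph extension of the ancestral graph `G`:
a Markov equivalent maximal ancestral supergraph. -/
def IsMAGExtension (G K : MixedGraph V) : Prop :=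
  Subgraph G K ∧ K.IsAncestral ∧ MarkovEquiv G K ∧ K.IsMaximal

/-- `G` contains a ribbon: a collider path `⟨i,j,k⟩` with no endpoint-identical edge
between `i` and `k` such that `j` or a descendant of `j` is selection adjacent
or lies on a directed cycle. -/
def hasRibbon (G : MixedGraph V) : Prop :=
  ∃ i j k m₁ m₂, i ≠ k ∧ G.edge i j m₁ Mark.arrow ∧ G.edge j k Mark.arrow m₂ ∧
    ¬ G.edge i k m₁ m₂ ∧ ∃ d, G.ancestor j d ∧ (G.selectionAdjacent d ∨ TransGen G.dirEdge d d)

/-- Ribbonless graph. -/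
def Ribbonless (G : MixedGraph V) : Prop := ¬ G.hasRibbon

/-- `K` is the maximal ribbonless extension of the ribbonless graph `G`. -/
def IsRGExtension (G K : MixedGraph V) : Prop :=
  Subgraph G K ∧ K.Ribbonless ∧ MarkovEquiv G K ∧ K.IsMaximal

/-- `⟨i,j,k⟩` is a collider path (both edges have an arrowhead at `j`). -/
def isCollider (G : MixedGraph V) (i j k : V) : Prop :=
  ∃ m₁ m₂, G.edge i j m₁ Mark.arrow ∧ G.edge j k Mark.arrow m₂

/-- A v-structure: a collider whose endpoints are nonadjacent. -/
def isVStructure (G : MixedGraph V) (i j k : V) : Prop := G.isCollider i j k ∧ ¬ G.adj i k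

/-- There is a discriminating path `⟨w 0, …, w m, w (m+1), w (m+2)⟩ = ⟨v₀,…,v_m,b,c⟩`
for the triple `⟨i,j,k⟩`, all of whose intermediate triples satisfy `P`:
`v₀` and `c` are nonadjacent, `v₁,…,v_m` are parents of `c`, and the triples
`⟨v₀,v₁,v₂⟩, …, ⟨v_{m-1},v_m,b⟩` satisfy `P`. -/
def discPathFor (G : MixedGraph V) (P : V → V → V → Prop) (i j k : V) : Prop :=
  ∃ (m : ℕ) (w : ℕ → V), 1 ≤ m ∧
    ((w m = i ∧ w (m + 1) = j ∧ w (m + 2) = k) ∨ (w m = k ∧ w (m + 1) = j ∧ w (m + 2) = i)) ∧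
    ¬ G.adj (w 0) (w (m + 2)) ∧
    (∀ l, 1 ≤ l → l ≤ m → G.dirEdge (w l) (w (m + 2))) ∧
    (∀ l l', l ≤ m + 2 → l' ≤ m + 2 → w l = w l' → l = l') ∧
    ∀ l, l + 2 ≤ m + 1 → P (w l) (w (l + 1)) (w (l + 2))

/-- `⟨i,j,k⟩` is a collider with order at most `t`. Order `0` colliders are
v-structures; a collider has order at most `t+1` if it has order at most `t` or
lies at the end of a discriminating path all of whose intermediate triples are
colliders of order at most `t`. -/
def colliderOrderLE (G : MixedGraph V) : ℕ → V → V → V → Prop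
  | 0, i, j, k => G.isCollider i j k ∧ ¬ G.adj i k
  | t + 1, i, j, k =>
      colliderOrderLE G t i j k ∨
        (G.isCollider i j k ∧ G.discPathFor (colliderOrderLE G t) i j k)

/-- `⟨i,j,k⟩` is a collider with order (for some order). -/
def hasColliderWithOrder (G : MixedGraph V) (i j k : V) : Prop := ∃ t, G.colliderOrderLE t i j k

/-- `⟨i,j,k⟩` is a collider with order exactly `t`. -/
def colliderOrderEq (G : MixedGraph V) (t : ℕ) (i j k : V) : Prop :=
  G.colliderOrderLE t i j k ∧ ∀ s < t, ¬ G.colliderOrderLE s i j k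

/-- `a` is anterior to `b`: there is a path from `a` to `b` consisting of undirected
edges followed by a directed path toward `b`. -/
def anteriorTo (G : MixedGraph V) (a b : V) : Prop :=
  ∃ c, ReflTransGen G.undirEdge a c ∧ ReflTransGen G.dirEdge c b

/-- The closure of the set of selection adjacent nodes under the operation of
consecutively removing arrowheads pointing into such nodes (`i → j − k` becomes
`i − j − k`, creating the new selection adjacent node `i`). -/
inductive selClosure (G : MixedGraph V) : V → Prop
  | base (a b : V) : G.undirEdge a b → selClosure G a
  | base' (a b : V) : G.undirEdge b a → selClosure G a
  | step (a b : V) : G.dirEdge a b → selClosure G b → selClosure G a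

/-- The anterior graph `G*` of `G`: consecutively remove all arrowheads pointing into
nodes adjacent to an undirected edge. -/
def anteriorGraph (G : MixedGraph V) : MixedGraph V where
  edge a b m₁ m₂ := ∃ n₁ n₂, G.edge a b n₁ n₂ ∧
    ((selClosure G a ∧ m₁ = Mark.tail) ∨ (¬ selClosure G a ∧ m₁ = n₁)) ∧
    ((selClosure G b ∧ m₂ = Mark.tail) ∨ (¬ selClosure G b ∧ m₂ = n₂))

/-- The set of parents of `i`. -/
def parentsSet (G : MixedGraph V) (i : V) : Set V := {a | G.dirEdge a i}

/-- The set of spouses of `i`. -/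
def spousesSet (G : MixedGraph V) (i : V) : Set V := {a | G.bidirEdge i a}

/-- The set of ancestors of a set `S` (including `S` itself). -/
def ancSet (G : MixedGraph V) (S : Set V) : Set V := {a | ∃ s ∈ S, G.ancestor a s}

/-- A set is ancestrally closed when it equals its set of ancestors. -/
def AncestrallyClosed (G : MixedGraph V) (A : Set V) : Prop := A = G.ancSet A

/-- The district of `i` in the induced subgraph on `A`: the connected component of `i`
under bidirected edges within `A`. -/
def districtIn (G : MixedGraph V) (A : Set V) (i : V) : Set V :=
  {j | j ∈ A ∧ ReflTransGen (fun x y => x ∈ A ∧ y ∈ A ∧ G.bidirEdge x y) i j}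

/-- Two vertices lie in a common district of `G`. -/
def sameDistrict (G : MixedGraph V) (a b : V) : Prop :=
  ∃ d, a ∈ G.districtIn Set.univ d ∧ b ∈ G.districtIn Set.univ d

/-- The barren subset of `A`: those `x ∈ A` with no proper descendants inside `A`. -/
def barren (G : MixedGraph V) (A : Set V) : Set V :=
  {x | x ∈ A ∧ ∀ y ∈ A, G.ancestor x y → y = x}

/-- The head-extraction step `Φ_G(A)`. -/
def headsStep (G : MixedGraph V) (A : Set V) : Set (Set V) :=
  {H | H.Nonempty ∧ H = ⋂ i ∈ H, G.barren (G.ancSet (G.districtIn A i))}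

/-- The residual step `Ψ_G(A)`. -/
def psi (G : MixedGraph V) (A : Set V) : Set V := A \ ⋃ H ∈ G.headsStep A, H

/-- The partition `[A]_G` of `A` into heads. -/
def heads (G : MixedGraph V) (A : Set V) : Set (Set V) :=
  {H | ∃ n : ℕ, H ∈ G.headsStep ((G.psi)^[n] A)}

/-- `dis_{an(H)}(H)`: the union of the districts of the elements of `H` in the induced
subgraph on the ancestors of `H`. -/
def headDistrict (G : MixedGraph V) (H : Set V) : Set V :=
  ⋃ i ∈ H, G.districtIn (G.ancSet H) i

/-- The tail of a head `H`: `(dis_{an(H)}(H) \ H) ∪ pa_G(dis_{an(H)}(H))`. -/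
def tailOf (G : MixedGraph V) (H : Set V) : Set V :=
  (G.headDistrict H \ H) ∪ {a | ∃ s ∈ G.headDistrict H, G.dirEdge a s}

end MixedGraph

/-- The index set `W_𝓘` of intervention nodes: (occurrences of) nonempty targets. -/
abbrev InterventionIndex {V ι : Type} (targets : ι → Set V) : Type :=
  {k : ι // (targets k).Nonempty}

/-- The interventional graph `G^𝓘`: add a source node `ω_I` for each nonempty target
`I ∈ 𝓘` together with the edges `ω_I → i` for all `i ∈ I`. -/
def interventionGraph {V ι : Type} (G : MixedGraph V) (targets : ι → Set V) :
    MixedGraph (V ⊕ InterventionIndex targets) where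
  edge a b m₁ m₂ :=
    match a, b with
    | Sum.inl a, Sum.inl b => G.edge a b m₁ m₂
    | Sum.inr k, Sum.inl b => b ∈ targets k.1 ∧ m₁ = Mark.tail ∧ m₂ = Mark.arrow
    | Sum.inl a, Sum.inr k => a ∈ targets k.1 ∧ m₁ = Mark.arrow ∧ m₂ = Mark.tail
    | Sum.inr _, Sum.inr _ => False

/-- The multiset of targets doubly-intervenes on `i`: two distinct elements of the
multiset both contain `i`. -/
def doublyIntervenes {V ι : Type} (targets : ι → Set V) (i : V) : Prop :=
  ∃ k k' : ι, k ≠ k' ∧ i ∈ targets k ∧ i ∈ targets k'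

/-- `𝓘`-Markov equivalence: the interventional graphs have the same independence models. -/
def IMarkovEquiv {V ι : Type} (G H : MixedGraph V) (targets : ι → Set V) : Prop :=
  MixedGraph.MarkovEquiv (interventionGraph G targets) (interventionGraph H targets)

/-- An `𝓘`-collider with order: a collider with order in `G^𝓘` that is not a collider
with order in `G`. -/
def IColliderWithOrder {V ι : Type} (G : MixedGraph V) (targets : ι → Set V)
    (i j k : V ⊕ InterventionIndex targets) : Prop :=
  (interventionGraph G targets).hasColliderWithOrder i j k ∧
    ¬ ∃ i' j' k' : V, i = Sum.inl i' ∧ j = Sum.inl j' ∧ k = Sum.inl k' ∧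
      G.hasColliderWithOrder i' j' k'

/-- An `𝓘`-v-structure: a v-structure of `G^𝓘` with an endpoint in `W_𝓘`. -/
def IVStructure {V ι : Type} (G : MixedGraph V) (targets : ι → Set V)
    (i j k : V ⊕ InterventionIndex targets) : Prop :=
  (interventionGraph G targets).isVStructure i j k ∧
    ((∃ κ, i = Sum.inr κ) ∨ (∃ κ, k = Sum.inr κ))

/-- The induced subgraph of a graph on `[p] ∪ W_𝓘` on the observed vertex set `[p]`. -/
def observedPart {V ι : Type} {targets : ι → Set V}
    (K : MixedGraph (V ⊕ InterventionIndex targets)) : MixedGraph V where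
  edge a b m₁ m₂ := K.edge (Sum.inl a) (Sum.inl b) m₁ m₂

theorem Mark.eq_tail_of_ne_arrow {m : Mark} (h : m ≠ Mark.arrow) : m = Mark.tail := by
  cases m
  · rfl
  · exact absurd rfl h

namespace MixedGraph

section MConnection

variable {V : Type} {G K : MixedGraph V}

/-- No arrowhead points at an endpoint of an undirected edge. -/
def NoArrowAtSelection (G : MixedGraph V) : Prop :=
  ∀ a, G.selectionAdjacent a → ∀ b m, ¬ G.edge b a m Mark.arrow

theorem ancestor_mem_ancSet {C : Set V} {u v : V} (h : G.ancestor u v) (hv : v ∈ G.ancSet C) :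
    u ∈ G.ancSet C := by
  obtain ⟨c, hc, hvc⟩ := hv
  exact ⟨c, hc, ReflTransGen.trans h hvc⟩

theorem dirEdge_mem_ancSet {C : Set V} {u v : V} (h : G.dirEdge u v) (hv : v ∈ G.ancSet C) :
    u ∈ G.ancSet C :=
  ancestor_mem_ancSet (ReflTransGen.single h) hv

theorem subset_ancSet (C : Set V) : C ⊆ G.ancSet C := fun c hc => ⟨c, hc, ReflTransGen.refl⟩

/-! ### Following tails along a walk -/

theorem MWalk.mem_of_arrow_into (hN : G.NoArrowAtSelection) (w : MWalk G)
    {P : V → Prop} (hP : ∀ u v, G.dirEdge u v → P v → P u)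
    (hc : ∀ i, w.colliderAt i → P (w.vtx i)) {n : ℕ} (hn : n ≤ w.len)
    (hend : w.mk₂ (n - 1) = Mark.arrow → P (w.vtx n)) {i : ℕ} (hi : 0 < i) (hin : i ≤ n)
    (harr : w.mk₂ (i - 1) = Mark.arrow) : P (w.vtx i) := by
  induction hin using Nat.decreasingInduction with
  | self => exact hend harr
  | of_succ k hk ih =>
    by_cases h1 : w.mk₁ k = Mark.arrow
    · exact hc k ⟨hi, by omega, harr, h1⟩
    have h1 := Mark.eq_tail_of_ne_arrow h1
    have he := w.isEdge k (by omega)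
    have hp := w.isEdge (k - 1) (by omega)
    rw [Nat.sub_add_cancel hi, harr] at hp
    rw [h1] at he
    have h2 : w.mk₂ k = Mark.arrow := by
      by_contra h2
      rw [Mark.eq_tail_of_ne_arrow h2] at he
      exact hN _ ⟨_, Or.inl he⟩ _ _ hp
    rw [h2] at he
    exact hP _ _ he (ih (by omega) h2)

theorem MWalk.mem_of_arrow_out (hG : G.IsLMG) (hN : G.NoArrowAtSelection) (w : MWalk G)
    {P : V → Prop} (hP : ∀ u v, G.dirEdge u v → P v → P u)
    (hc : ∀ i, w.colliderAt i → P (w.vtx i)) (hstart : P (w.vtx 0)) {i : ℕ} (hi : i < w.len)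
    (harr : w.mk₁ i = Mark.arrow) : P (w.vtx i) := by
  induction i with
  | zero => exact hstart
  | succ k ih =>
    by_cases h2 : w.mk₂ k = Mark.arrow
    · exact hc (k + 1) ⟨by omega, hi, h2, harr⟩
    have h2 := Mark.eq_tail_of_ne_arrow h2
    have he := hG.1 _ _ _ _ (w.isEdge k (by omega))
    have hp := hG.1 _ _ _ _ (w.isEdge (k + 1) hi)
    rw [harr] at hp
    rw [h2] at he
    have h1 : w.mk₁ k = Mark.arrow := by
      by_contra h1
      rw [Mark.eq_tail_of_ne_arrow h1] at he
      exact hN _ ⟨_, Or.inl he⟩ _ _ hp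
    rw [h1] at he
    exact hP _ _ he (ih (by omega) h1)

/-! ### From m-connecting walks to m-connecting paths -/

/-- Cut out the part of a walk between two visits `s < t` of the same vertex. -/
def MWalk.cut (w : MWalk G) (s t : ℕ) (hst : s < t) (ht : t ≤ w.len)
    (h : w.vtx s = w.vtx t) : MWalk G where
  len := w.len - (t - s)
  vtx i := if i < s then w.vtx i else w.vtx (i + (t - s))
  mk₁ i := if i < s then w.mk₁ i else w.mk₁ (i + (t - s))
  mk₂ i := if i < s then w.mk₂ i else w.mk₂ (i + (t - s))
  isEdge i hi := by
    by_cases h1 : i < s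
    · have he := w.isEdge i (by omega)
      by_cases h2 : i + 1 < s
      · simpa [h1, h2] using he
      · obtain rfl : i + 1 = s := by omega
        have : i + 1 + (t - (i + 1)) = t := by omega
        simpa [this, ← h] using he
    · have h2 : ¬ i + 1 < s := by omega
      have he := w.isEdge (i + (t - s)) (by omega)
      have : i + 1 + (t - s) = i + (t - s) + 1 := by omega
      simpa [h1, h2, this] using he

theorem MWalk.mConnecting_cut (hN : G.NoArrowAtSelection) {C : Set V}
    (w : MWalk G) (hw : w.mConnecting C) (s t : ℕ) (hst : s < t) (ht : t ≤ w.len)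
    (h : w.vtx s = w.vtx t) : (w.cut s t hst ht h).mConnecting C := by
  have key : ∀ i, (i < s ∧ (w.cut s t hst ht h).vtx i = w.vtx i ∧
        ((w.cut s t hst ht h).colliderAt i ↔ w.colliderAt i)) ∨
      (s < i ∧ (w.cut s t hst ht h).vtx i = w.vtx (i + (t - s)) ∧
        ((w.cut s t hst ht h).colliderAt i ↔ w.colliderAt (i + (t - s)))) ∨
      (i = s ∧ (w.cut s t hst ht h).vtx i = w.vtx s ∧
        ((w.cut s t hst ht h).colliderAt i ↔ (0 < s ∧ t < w.len ∧
          w.mk₂ (s - 1) = Mark.arrow ∧ w.mk₁ t = Mark.arrow))) := by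
    intro i
    rcases lt_trichotomy i s with his | rfl | his
    · refine Or.inl ⟨his, by simp [cut, his], ?_⟩
      have h1 : i - 1 < s := by omega
      have h2 : i < w.len - (t - s) ↔ i < w.len := by omega
      simp [colliderAt, cut, his, h1, h2]
    · refine Or.inr (Or.inr ⟨rfl, ?_, ?_⟩)
      · have h1 : i + (t - i) = t := by omega
        simp [cut, h1, h]
      · have h1 : i + (t - i) = t := by omega
        have h2 : i < w.len - (t - i) ↔ t < w.len := by omega
        rcases Nat.eq_zero_or_pos i with h0 | h0
        · simp [colliderAt, h0]
        · simp [colliderAt, cut, h1, h2, h0]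
    · refine Or.inr (Or.inl ⟨his, ?_, ?_⟩)
      · have h1 : ¬ i < s := by omega
        simp [cut, h1]
      · have h1 : ¬ i < s := by omega
        have h2 : ¬ i - 1 < s := by omega
        have h3 : i - 1 + (t - s) = i + (t - s) - 1 := by omega
        have h4 : i < w.len - (t - s) ↔ i + (t - s) < w.len := by omega
        have h5 : 0 < i := by omega
        have h6 : 0 < i + (t - s) := by omega
        simp only [colliderAt, cut, h1, h2, h3, h4, h5, h6, if_false]
  constructor
  · intro i hi
    rcases key i with ⟨_, hv, hc⟩ | ⟨_, hv, hc⟩ | ⟨_, hv, hc⟩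
    · rw [hv]; exact hw.1 _ (hc.1 hi)
    · rw [hv]; exact hw.1 _ (hc.1 hi)
    · rw [hv]
      obtain ⟨h0, htl, h2, h1⟩ := hc.1 hi
      exact w.mem_of_arrow_into hN (P := fun v => v ∈ G.ancSet C)
        (fun _ _ => dirEdge_mem_ancSet) hw.1 ht
        (fun ha => hw.1 t ⟨by omega, htl, ha, h1⟩) h0 hst.le h2
  · intro i hil hi
    have hil : i ≤ w.len - (t - s) := hil
    rcases key i with ⟨_, hv, hc⟩ | ⟨_, hv, hc⟩ | ⟨_, hv, hc⟩
    · rw [hv]; exact hw.2 _ (by omega) (mt hc.2 hi)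
    · rw [hv]; exact hw.2 _ (by omega) (mt hc.2 hi)
    · rw [hv]
      by_cases hs : w.colliderAt s
      · rw [h]
        refine hw.2 t ht fun htc => hi (hc.2 ⟨hs.1, htc.2.1, hs.2.2.1, htc.2.2.2⟩)
      · exact hw.2 s (by omega) hs

theorem MWalk.mConnected_of_mConnecting (hN : G.NoArrowAtSelection) {C : Set V}
    (w : MWalk G) (hw : w.mConnecting C) : G.mConnected (w.vtx 0) (w.vtx w.len) C := by
  induction hl : w.len using Nat.strong_induction_on generalizing w with
  | _ n ih =>
    subst hl
    by_cases hp : w.IsPath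
    · exact ⟨w, hp, rfl, rfl, hw⟩
    obtain ⟨s, t, hst, ht, h⟩ : ∃ s t, s < t ∧ t ≤ w.len ∧ w.vtx s = w.vtx t := by
      simp only [IsPath, not_forall] at hp
      obtain ⟨i, j, hi, hj, hij, hne⟩ := hp
      rcases lt_or_gt_of_ne hne with hlt | hlt
      · exact ⟨i, j, hlt, hj, hij⟩
      · exact ⟨j, i, hlt, hi, hij.symm⟩
    have hlen : (w.cut s t hst ht h).len = w.len - (t - s) := rfl
    have := ih _ (by omega) (w.cut s t hst ht h) (w.mConnecting_cut hN hw s t hst ht h) rfl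
    convert this using 1
    · by_cases h0 : 0 < s
      · simp [cut, h0]
      · obtain rfl : s = 0 := by omega
        simpa [cut] using h
    · have h1 : ¬ w.len - (t - s) < s := by omega
      have h2 : w.len - (t - s) + (t - s) = w.len := by omega
      simp [cut, h1, h2]

/-! ### Walks built edge by edge -/

/-- `G.Reach S C x v m`: some nontrivial walk from `x` arrives at `v` with mark `m`, its
colliders lie in `S`, and its starting vertex and interior noncolliders lie outside `C`. -/
inductive Reach (G : MixedGraph V) (S C : Set V) (x : V) : V → Mark → Prop
  | single {v : V} {m₁ m₂ : Mark} : x ∉ C → G.edge x v m₁ m₂ → Reach G S C x v m₂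
  | step {v u : V} {m m₁ m₂ : Mark} : Reach G S C x v m → G.edge v u m₁ m₂ →
      (m = Mark.arrow → m₁ = Mark.arrow → v ∈ S) →
      (¬ (m = Mark.arrow ∧ m₁ = Mark.arrow) → v ∉ C) → Reach G S C x u m₂

theorem Reach.exists_walk {C : Set V} {x v : V} {m : Mark} (h : G.Reach (G.ancSet C) C x v m) :
    ∃ w : MWalk G, 0 < w.len ∧ w.vtx 0 = x ∧ w.vtx w.len = v ∧ w.mk₂ (w.len - 1) = m ∧
      (∀ i, w.colliderAt i → w.vtx i ∈ G.ancSet C) ∧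
      ∀ i, i < w.len → ¬ w.colliderAt i → w.vtx i ∉ C := by
  induction h with
  | @single v m₁ m₂ hx he =>
    refine ⟨⟨1, fun i => if i = 0 then x else v, fun _ => m₁, fun _ => m₂, ?_⟩,
      by simp, by simp, by simp, rfl, ?_, ?_⟩
    · intro i hi
      obtain rfl : i = 0 := by omega
      simpa using he
    · rintro i ⟨h0, h1, _⟩
      simp only at h1
      omega
    · intro i hi _
      obtain rfl : i = 0 := by simpa using hi
      simpa using hx
  | @step v u m m₁ m₂ _ he hS hC ih =>
    obtain ⟨w, hl, h0, hv, hm, hc, hn⟩ := ih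
    have hcol : ∀ i, i < w.len + 1 →
        ((0 < i ∧ i < w.len + 1 ∧ (if i - 1 < w.len then w.mk₂ (i - 1) else m₂) = Mark.arrow ∧
          (if i < w.len then w.mk₁ i else m₁) = Mark.arrow) ↔
        (w.colliderAt i ∨ (i = w.len ∧ m = Mark.arrow ∧ m₁ = Mark.arrow))) := by
      intro i hi
      rcases Nat.lt_or_ge i w.len with h | h
      · have h1 : i - 1 < w.len := by omega
        have h2 : i ≠ w.len := by omega
        simp [MWalk.colliderAt, h, h1, h2, hi]
      · obtain rfl : i = w.len := by omega
        simp [MWalk.colliderAt, hl, hm]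
    refine ⟨⟨w.len + 1, fun i => if i ≤ w.len then w.vtx i else u,
      fun i => if i < w.len then w.mk₁ i else m₁, fun i => if i < w.len then w.mk₂ i else m₂, ?_⟩,
      by simp, by simpa using h0, by simp, by simp, ?_, ?_⟩
    · intro i hi
      rcases Nat.lt_or_ge i w.len with h | h
      · simpa [h, h.le, Nat.succ_le_of_lt h] using w.isEdge i h
      · obtain rfl : i = w.len := by omega
        simpa [hv] using he
    · intro i hi
      have hil : i < w.len + 1 := hi.2.1
      have hil' : i ≤ w.len := by omega
      simp only [hil', if_true]
      rcases (hcol i hil).1 hi with h | ⟨rfl, h1, h2⟩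
      · exact hc i h
      · rw [hv]; exact hS h1 h2
    · intro i hil hi
      have hil : i < w.len + 1 := hil
      have hil' : i ≤ w.len := by omega
      have hi := mt (hcol i hil).2 hi
      push Not at hi
      simp only [hil', if_true]
      rcases Nat.lt_or_ge i w.len with h | h
      · exact hn i h hi.1
      · obtain rfl : i = w.len := by omega
        rw [hv]
        exact hC fun hh => hi.2 rfl hh.1 hh.2

theorem Reach.mConnected (hN : G.NoArrowAtSelection) {C : Set V} {x y : V}
    {m : Mark} (h : G.Reach (G.ancSet C) C x y m) (hy : y ∉ C) : G.mConnected x y C := by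
  obtain ⟨w, hl, rfl, rfl, -, hc, hn⟩ := h.exists_walk
  refine w.mConnected_of_mConnecting hN ⟨hc, fun i hi hi' => ?_⟩
  rcases hi.lt_or_eq with h | rfl
  · exact hn i h hi'
  · exact hy

/-! ### Colliders that are ancestors of the endpoints -/

theorem Reach.of_ancestor_start (hG : G.IsLMG) {S C : Set V} {x v : V} (hx : x ∉ C)
    (h : G.ancestor v x) (hv : v ∉ G.ancSet C) : v = x ∨ G.Reach S C x v Mark.tail := by
  induction h using ReflTransGen.head_induction_on with
  | refl => exact Or.inl rfl
  | @head v u hvu _ ih =>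
    have hu : u ∉ G.ancSet C := fun hu => hv (dirEdge_mem_ancSet hvu hu)
    refine Or.inr ?_
    rcases ih hu with rfl | ih
    · exact Reach.single hx (hG.1 _ _ _ _ hvu)
    · exact ih.step (hG.1 _ _ _ _ hvu) (by simp) fun _ h => hu (subset_ancSet C h)

theorem Reach.eliminate_start (hG : G.IsLMG) {S S' C : Set V} {x v : V} {m : Mark}
    (hS : ∀ u ∈ S', u ∉ S → u ∉ G.ancSet C ∧ G.ancestor u x)
    (h : G.Reach S' C x v m) : G.Reach S C x v m := by
  have hx : x ∉ C := by
    induction h with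
    | single hx _ => exact hx
    | step _ _ _ _ ih => exact ih
  induction h with
  | single _ he => exact Reach.single hx he
  | @step v u m m₁ m₂ _ he hcol hC ih =>
    by_cases hvS : m = Mark.arrow ∧ m₁ = Mark.arrow ∧ v ∉ S
    · obtain ⟨h1, h2, h3⟩ := hvS
      obtain ⟨hvC, hvx⟩ := hS v (hcol h1 h2) h3
      rcases Reach.of_ancestor_start (S := S) hG hx hvx hvC with rfl | hr
      · exact Reach.single hx he
      · exact hr.step he (by simp) fun _ h => hvC (subset_ancSet C h)
    · push Not at hvS
      exact ih.step he (fun h1 h2 => hvS h1 h2) hC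

theorem Reach.follow {S C : Set V} {x v y : V} {m : Mark} (h : G.Reach S C x v m)
    (hvy : G.ancestor v y) (hv : v ∉ G.ancSet C) : ∃ m', G.Reach S C x y m' := by
  induction hvy using ReflTransGen.head_induction_on generalizing m with
  | refl => exact ⟨m, h⟩
  | @head v u hvu _ ih =>
    have hu : u ∉ G.ancSet C := fun hu => hv (dirEdge_mem_ancSet hvu hu)
    exact ih (h.step hvu (by simp) fun _ h => hv (subset_ancSet C h)) hu

theorem Reach.eliminate_end {S S' C : Set V} {x y v : V} {m : Mark}
    (hS : ∀ u ∈ S', u ∉ S → u ∉ G.ancSet C ∧ G.ancestor u y)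
    (h : G.Reach S' C x v m) : G.Reach S C x v m ∨ ∃ m', G.Reach S C x y m' := by
  induction h with
  | single hx he => exact Or.inl (Reach.single hx he)
  | @step v u m m₁ m₂ _ he hcol hC ih =>
    rcases ih with ih | ih
    · by_cases hvS : m = Mark.arrow ∧ m₁ = Mark.arrow ∧ v ∉ S
      · obtain ⟨h1, h2, h3⟩ := hvS
        obtain ⟨hvC, hvy⟩ := hS v (hcol h1 h2) h3
        exact Or.inr (ih.follow hvy hvC)
      · push Not at hvS
        exact Or.inl (ih.step he (fun h1 h2 => hvS h1 h2) hC)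
    · exact Or.inr ih

/-- Colliders may be ancestors of the endpoints instead of the conditioning set. -/
theorem Reach.weaken (hG : G.IsLMG) {C : Set V} {x y : V} {m : Mark}
    (h : G.Reach (G.ancSet (C ∪ {x, y})) C x y m) : ∃ m', G.Reach (G.ancSet C) C x y m' := by
  have h' : G.Reach (G.ancSet C ∪ {u | G.ancestor u y}) C x y m := by
    refine h.eliminate_start hG fun u hu hu' => ?_
    simp only [Set.mem_union, Set.mem_ofPred_eq, not_or] at hu'
    refine ⟨hu'.1, ?_⟩
    obtain ⟨c, hc | rfl | rfl, huc⟩ := hu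
    · exact absurd ⟨c, hc, huc⟩ hu'.1
    · exact huc
    · exact absurd huc hu'.2
  rcases h'.eliminate_end (S := G.ancSet C) (y := y) fun u hu hu' =>
    ⟨hu', hu.resolve_left hu'⟩ with h | h
  · exact ⟨m, h⟩
  · exact h

/-! ### Adding bidirected edges along inducing paths -/

/-- `a` and `b` are joined by a path of bidirected edges inside the ancestors of `{a, b}`. -/
def BidirInducing (G : MixedGraph V) (a b : V) : Prop :=
  TransGen (fun u v => G.bidirEdge u v ∧ u ∈ G.ancSet {a, b} ∧ v ∈ G.ancSet {a, b}) a b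

theorem BidirInducing.reach {S C : Set V} {a b x : V} (h : G.BidirInducing a b)
    (hS : G.ancSet {a, b} ⊆ S)
    (hstart : ∀ v, G.bidirEdge a v → G.Reach S C x v Mark.arrow) :
    G.Reach S C x b Mark.arrow := by
  revert hS
  unfold BidirInducing at h
  generalize G.ancSet {a, b} = A at h
  intro hS
  induction h with
  | single h => exact hstart _ h.1
  | tail _ h ih => exact ih.step h.1 (fun _ _ => hS h.2.1) (by simp)

theorem BidirInducing.exists_first {a b : V} (h : G.BidirInducing a b) :
    ∃ v, G.bidirEdge a v ∧ v ∈ G.ancSet {a, b} := by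
  obtain ⟨v, hv, -⟩ := TransGen.head'_iff.1 h
  exact ⟨v, hv.1, hv.2.2⟩

theorem BidirInducing.exists_last {a b : V} (h : G.BidirInducing a b) :
    ∃ v, G.bidirEdge v b ∧ v ∈ G.ancSet {a, b} := by
  obtain ⟨v, -, hv⟩ := TransGen.tail'_iff.1 h
  exact ⟨v, hv.1, hv.2.1⟩

theorem ancestor_mono (h : Subgraph G K) {u v : V} (huv : G.ancestor u v) : K.ancestor u v :=
  ReflTransGen.mono (fun _ _ he => h _ _ _ _ he) _ _ huv

theorem ancSet_mono (h : Subgraph G K) (C : Set V) : G.ancSet C ⊆ K.ancSet C :=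
  fun _ ⟨c, hc, huc⟩ => ⟨c, hc, ancestor_mono h huc⟩

theorem NoArrowAtSelection.of_subgraph (h : Subgraph G K) (hK : K.NoArrowAtSelection) :
    G.NoArrowAtSelection := by
  rintro a ⟨b, hb⟩ c m he
  exact hK a ⟨b, hb.imp (h _ _ _ _) (h _ _ _ _)⟩ c m (h _ _ _ _ he)

theorem markovEquiv_iff : MarkovEquiv G K ↔
    ∀ a b C, a ≠ b → (G.mConnected a b C ↔ K.mConnected a b C) := by
  constructor
  · intro h a b C hab
    have := h {a} {b} C
    simp only [indep, mSep, Set.disjoint_singleton, Set.mem_singleton_iff, forall_eq] at this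
    exact not_iff_not.1 (by simpa [hab] using this)
  · intro h A B C
    refine and_congr_right fun hd => ?_
    refine forall₄_congr fun a ha b hb => not_congr (h a b C ?_)
    rintro rfl
    exact Set.disjoint_left.1 hd ha hb

theorem MarkovEquiv.symm (h : MarkovEquiv G K) : MarkovEquiv K G := fun A B C => (h A B C).symm

theorem MarkovEquiv.trans {L : MixedGraph V} (h : MarkovEquiv G K) (h' : MarkovEquiv K L) :
    MarkovEquiv G L := fun A B C => (h A B C).trans (h' A B C)

theorem mConnected_mono (h : Subgraph G K) {a b : V} {C : Set V} (hc : G.mConnected a b C) :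
    K.mConnected a b C := by
  obtain ⟨w, hp, h0, hl, hw⟩ := hc
  refine ⟨⟨w.len, w.vtx, w.mk₁, w.mk₂, fun i hi => h _ _ _ _ (w.isEdge i hi)⟩, hp, h0, hl, ?_, hw.2⟩
  intro i hi
  obtain ⟨c, hc, hic⟩ := hw.1 i hi
  exact ⟨c, hc, ancestor_mono h hic⟩

theorem markovEquiv_of_bidirInducing (hG : G.IsLMG) (hK : K.IsLMG) (hN : K.NoArrowAtSelection)
    (hGK : Subgraph G K)
    (hnew : ∀ a b m₁ m₂, K.edge a b m₁ m₂ → G.edge a b m₁ m₂ ∨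
      (m₁ = Mark.arrow ∧ m₂ = Mark.arrow ∧ G.BidirInducing a b)) :
    MarkovEquiv G K := by
  refine markovEquiv_iff.2 fun x y C hxy => ⟨mConnected_mono hGK, ?_⟩
  have hanc : ∀ D, K.ancSet D ⊆ G.ancSet D := by
    rintro D u ⟨c, hc, huc⟩
    refine ⟨c, hc, ReflTransGen.mono (fun a b hab => ?_) _ _ huc⟩
    rcases hnew _ _ _ _ hab with h | ⟨h, -⟩
    · exact h
    · cases h
  rintro ⟨w, -, rfl, rfl, hw⟩
  set S := G.ancSet (C ∪ {w.vtx 0, w.vtx w.len}) with hSdef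
  have hdir : ∀ u v, K.dirEdge u v → v ∈ S → u ∈ S := fun u v huv hv =>
    hanc _ (dirEdge_mem_ancSet huv (ancSet_mono hGK _ hv))
  have hcol : ∀ i, w.colliderAt i → w.vtx i ∈ S := by
    intro i hi
    obtain ⟨c, hc, hic⟩ := hanc C (hw.1 i hi)
    exact ⟨c, Or.inl hc, hic⟩
  have h0S : w.vtx 0 ∈ S := subset_ancSet _ (by simp)
  have hlS : w.vtx w.len ∈ S := subset_ancSet _ (by simp)
  have hin : ∀ i, i < w.len → w.mk₂ i = Mark.arrow → w.vtx (i + 1) ∈ S := fun i hi ha =>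
    w.mem_of_arrow_into hN (P := (· ∈ S)) hdir hcol le_rfl (fun _ => hlS) (by omega) hi ha
  have hout : ∀ i, i < w.len → w.mk₁ i = Mark.arrow → w.vtx i ∈ S := fun i hi ha =>
    w.mem_of_arrow_out hK hN (P := (· ∈ S)) hdir hcol h0S hi ha
  have hsub : ∀ a ∈ S, ∀ b ∈ S, G.ancSet {a, b} ⊆ S := by
    rintro a ha b hb u ⟨c, rfl | rfl, huc⟩
    · exact ancestor_mem_ancSet huc ha
    · exact ancestor_mem_ancSet huc hb
  have h0C : w.vtx 0 ∉ C := hw.2 0 (Nat.zero_le _) fun h => h.1.false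
  have hreach : ∀ i, i < w.len → G.Reach S C (w.vtx 0) (w.vtx (i + 1)) (w.mk₂ i) := by
    intro i hi
    induction i with
    | zero =>
      rcases hnew _ _ _ _ (w.isEdge 0 hi) with he | ⟨h1, h2, hB⟩
      · exact Reach.single h0C he
      · rw [h2]
        exact hB.reach (hsub _ (hout 0 hi h1) _ (hin 0 hi h2)) fun v hv => Reach.single h0C hv
    | succ k ih =>
      have ih := ih (by omega)
      have hC : ¬ (w.mk₂ k = Mark.arrow ∧ w.mk₁ (k + 1) = Mark.arrow) → w.vtx (k + 1) ∉ C :=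
        fun h => hw.2 _ hi.le fun h' => h h'.2.2
      rcases hnew _ _ _ _ (w.isEdge (k + 1) hi) with he | ⟨h1, h2, hB⟩
      · exact ih.step he (fun h1 _ => hin k (by omega) h1) hC
      · rw [h2]
        refine hB.reach (hsub _ (hout _ hi h1) _ (hin _ hi h2)) fun v hv => ?_
        rw [h1] at hC
        exact ih.step hv (fun h1 _ => hin k (by omega) h1) hC
  have hlen : 0 < w.len := Nat.pos_of_ne_zero fun h => hxy (by rw [h])
  have hfin := hreach (w.len - 1) (by omega)
  rw [Nat.sub_add_cancel hlen] at hfin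
  obtain ⟨m', hm'⟩ := hfin.weaken hG
  exact hm'.mConnected (hN.of_subgraph hGK) (hw.2 _ le_rfl fun h => h.2.1.false)

/-! ### Separating nonadjacent vertices in ancestral graphs -/

theorem ancestor_of_anterior (hN : G.NoArrowAtSelection) {v z : V}
    (h : ReflTransGen (fun u v => ∃ m, G.edge u v Mark.tail m) v z)
    (hv : ∃ c m, G.edge c v m Mark.arrow) : G.ancestor v z := by
  induction h using ReflTransGen.head_induction_on with
  | refl => exact ReflTransGen.refl
  | @head v u hvu _ ih =>
    obtain ⟨m, hm⟩ := hvu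
    cases m with
    | tail =>
      obtain ⟨c, m, hc⟩ := hv
      exact absurd hc (hN v ⟨u, Or.inl hm⟩ c m)
    | arrow => exact ReflTransGen.head hm (ih ⟨v, _, hm⟩)

theorem transGen_of_ancestor {u v : V} (h : G.ancestor u v) (hne : u ≠ v) :
    TransGen G.dirEdge u v :=
  (reflTransGen_iff_eq_or_transGen.1 h).resolve_left fun h => hne h.symm

theorem IsAncestral.not_ancestor_of_arrow (hG : G.IsAncestral) {u v : V} {m : Mark}
    (h : G.edge v u m Mark.arrow) : ¬ G.ancestor u v := by
  intro hanc
  have hT := transGen_of_ancestor hanc fun huv : u = v => hG.1.2 v _ _ (huv ▸ h)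
  cases m with
  | tail => exact hG.2.1 _ (TransGen.head h hT)
  | arrow => exact (hG.2.2.1 _ _ h).2 hT

/-- The end edges of an inducing path of an ancestral graph have arrowheads at both ends. -/
theorem IsAncestral.arrow_of_inducing_ends (hG : G.IsAncestral) {a b u v : V} {m n : Mark}
    (hau : G.edge a u m Mark.arrow) (hbv : G.edge b v n Mark.arrow)
    (hu : G.ancestor u a ∨ G.ancestor u b) (hv : G.ancestor v a ∨ G.ancestor v b) :
    m = Mark.arrow := by
  by_contra hm
  rw [Mark.eq_tail_of_ne_arrow hm] at hau
  have hub := hu.resolve_left (hG.not_ancestor_of_arrow hau)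
  have hab : G.ancestor a b := ReflTransGen.head hau hub
  exact hG.not_ancestor_of_arrow hbv (hv.elim (fun h => h.trans hab) id)

theorem IsAncestral.bidirInducing_of_forall_mConnected (hG : G.IsAncestral) {a b : V}
    (hab : a ≠ b) (hadj : ¬ G.adj a b)
    (hcon : ∀ Z, a ∉ Z → b ∉ Z → G.mConnected a b Z) : G.BidirInducing a b := by
  have hL := hG.1
  have hN : G.NoArrowAtSelection := hG.2.2.2
  let T : V → V → Prop := fun u v => ∃ m, G.edge u v Mark.tail m
  let ant : V → Prop := fun v => ReflTransGen T v a ∨ ReflTransGen T v b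
  have hT : ∀ u v, T u v → ant v → ant u := fun u v huv hv =>
    hv.imp (ReflTransGen.head huv) (ReflTransGen.head huv)
  obtain ⟨w, hp, h0, hl, hw⟩ := hcon {v | v ≠ a ∧ v ≠ b ∧ ant v} (by simp) (by simp)
  have hanta : ant (w.vtx 0) := h0 ▸ Or.inl ReflTransGen.refl
  have hantb : ant (w.vtx w.len) := hl ▸ Or.inr ReflTransGen.refl
  have hcol : ∀ i, w.colliderAt i → ant (w.vtx i) := by
    intro i hi
    obtain ⟨c, hc, hic⟩ := hw.1 i hi
    have : ReflTransGen T (w.vtx i) c := ReflTransGen.mono (fun _ _ h => ⟨_, h⟩) _ _ hic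
    exact hc.2.2.imp this.trans this.trans
  have hfwd : ∀ i, i ≤ w.len → (i < w.len → w.mk₁ i = Mark.tail) → ant (w.vtx i) := by
    intro i hi
    induction hi using Nat.decreasingInduction with
    | self => exact fun _ => hantb
    | of_succ k hk ih =>
      intro ht
      have he := w.isEdge k hk
      rw [ht hk] at he
      refine hT _ _ ⟨_, he⟩ ?_
      by_cases hc : w.colliderAt (k + 1)
      · exact hcol _ hc
      refine ih fun hk' => Mark.eq_tail_of_ne_arrow fun h1 => ?_
      have h2 : w.mk₂ k = Mark.tail :=
        Mark.eq_tail_of_ne_arrow fun h2 => hc ⟨by omega, hk', h2, h1⟩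
      have he' := hL.1 _ _ _ _ (w.isEdge (k + 1) hk')
      rw [h1] at he'
      rw [h2] at he
      exact hN _ ⟨_, Or.inr he⟩ _ _ he'
  have hbwd : ∀ i, i < w.len → w.mk₂ i = Mark.tail → ant (w.vtx (i + 1)) := by
    intro i hi
    induction i with
    | zero =>
      intro ht
      have he := hL.1 _ _ _ _ (w.isEdge 0 hi)
      rw [ht] at he
      exact hT _ _ ⟨_, he⟩ hanta
    | succ k ih =>
      intro ht
      have he := hL.1 _ _ _ _ (w.isEdge (k + 1) hi)
      rw [ht] at he
      refine hT _ _ ⟨_, he⟩ ?_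
      by_cases hc : w.colliderAt (k + 1)
      · exact hcol _ hc
      refine ih (by omega) (Mark.eq_tail_of_ne_arrow fun h2 => ?_)
      have h1 : w.mk₁ (k + 1) = Mark.tail :=
        Mark.eq_tail_of_ne_arrow fun h1 => hc ⟨by omega, hi, h2, h1⟩
      have he' := w.isEdge k (by omega)
      rw [h2] at he'
      rw [h1] at he
      exact hN _ ⟨_, Or.inr he⟩ _ _ he'
  have hall : ∀ i, 0 < i → i < w.len → w.colliderAt i := by
    intro i hi0 hil
    by_contra hc
    refine hw.2 i hil.le hc ⟨?_, ?_, ?_⟩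
    · rw [← h0]
      exact fun h => hi0.ne' (hp _ _ hil.le (Nat.zero_le _) h)
    · rw [← hl]
      exact fun h => hil.ne (hp _ _ hil.le le_rfl h)
    · by_cases h1 : w.mk₁ i = Mark.arrow
      · have h2 := hbwd (i - 1) (by omega)
          (Mark.eq_tail_of_ne_arrow fun h2 => hc ⟨hi0, hil, h2, h1⟩)
        rwa [Nat.sub_add_cancel hi0] at h2
      · exact hfwd i hil.le fun _ => Mark.eq_tail_of_ne_arrow h1
  have hanc : ∀ i, 0 < i → i < w.len → G.ancestor (w.vtx i) a ∨ G.ancestor (w.vtx i) b := by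
    intro i hi0 hil
    have hc := hall i hi0 hil
    have he := w.isEdge (i - 1) (by omega)
    rw [Nat.sub_add_cancel hi0, hc.2.2.1] at he
    exact (hcol i hc).imp (ancestor_of_anterior hN · ⟨_, _, he⟩)
      (ancestor_of_anterior hN · ⟨_, _, he⟩)
  have hlen : 2 ≤ w.len := by
    by_contra hlt
    have hcases : w.len = 0 ∨ w.len = 1 := by omega
    rcases hcases with h | h
    · rw [h, h0] at hl
      exact hab hl
    · have he := w.isEdge 0 (by omega)
      rw [h] at hl
      rw [h0, hl] at he
      exact hadj ⟨_, _, he⟩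
  have hfirst := w.isEdge 0 (by omega)
  have hlast := hL.1 _ _ _ _ (w.isEdge (w.len - 1) (by omega))
  have hs : w.len - 1 + 1 = w.len := by omega
  rw [h0, (hall 1 (by omega) (by omega)).2.2.1] at hfirst
  rw [hs, hl, (hall (w.len - 1) (by omega) (by omega)).2.2.2] at hlast
  have hA1 := hanc 1 (by omega) (by omega)
  have hA2 := hanc (w.len - 1) (by omega) (by omega)
  have hm1 := hG.arrow_of_inducing_ends hfirst hlast hA1 hA2
  have hm2 := hG.arrow_of_inducing_ends hlast hfirst hA2.symm hA1.symm
  have hbi : ∀ i, i < w.len → G.bidirEdge (w.vtx i) (w.vtx (i + 1)) := by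
    intro i hi
    have he := w.isEdge i hi
    have h1 : w.mk₁ i = Mark.arrow := by
      rcases Nat.eq_zero_or_pos i with rfl | hi0
      · exact hm1
      · exact (hall i hi0 hi).2.2.2
    have h2 : w.mk₂ i = Mark.arrow := by
      rcases Nat.lt_or_ge (i + 1) w.len with hi1 | hi1
      · exact (hall (i + 1) (by omega) hi1).2.2.1
      · obtain rfl : i = w.len - 1 := by omega
        exact hm2
    rwa [h1, h2] at he
  have hmem : ∀ i, i ≤ w.len → w.vtx i ∈ G.ancSet {a, b} := by
    intro i hi
    rcases Nat.eq_zero_or_pos i with rfl | hi0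
    · exact subset_ancSet _ (by simp [h0])
    rcases hi.lt_or_eq with hil | rfl
    · rcases hanc i hi0 hil with h | h
      · exact ⟨a, by simp, h⟩
      · exact ⟨b, by simp, h⟩
    · exact subset_ancSet _ (by simp [hl])
  have hchain : ∀ i, i < w.len → TransGen
      (fun u v => G.bidirEdge u v ∧ u ∈ G.ancSet {a, b} ∧ v ∈ G.ancSet {a, b})
      a (w.vtx (i + 1)) := by
    intro i hi
    induction i with
    | zero =>
      have := hbi 0 hi
      rw [h0] at this
      exact TransGen.single ⟨this, subset_ancSet _ (by simp), hmem _ hi⟩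
    | succ k ih => exact (ih (by omega)).tail ⟨hbi _ hi, hmem _ hi.le, hmem _ hi⟩
  have := hchain (w.len - 1) (by omega)
  rwa [hs, hl] at this

theorem mConnected_of_edge (hG : G.IsLMG) {a b : V} {m₁ m₂ : Mark} (h : G.edge a b m₁ m₂)
    {Z : Set V} (ha : a ∉ Z) (hb : b ∉ Z) : G.mConnected a b Z := by
  have hab : a ≠ b := by
    rintro rfl
    exact hG.2 _ _ _ h
  refine ⟨⟨1, fun i => if i = 0 then a else b, fun _ => m₁, fun _ => m₂, ?_⟩, ?_, by simp, by simp,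
    ?_, ?_⟩
  · intro i hi
    obtain rfl : i = 0 := by omega
    simpa using h
  · intro i j hi hj hij
    have hi : i ≤ 1 := hi
    have hj : j ≤ 1 := hj
    have hij : (if i = 0 then a else b) = if j = 0 then a else b := hij
    split_ifs at hij
    · omega
    · exact absurd hij hab
    · exact absurd hij.symm hab
    · omega
  · rintro i ⟨h0, h1, _⟩
    have h1 : i < 1 := h1
    omega
  · intro i _ _
    change (if i = 0 then a else b) ∉ Z
    split_ifs
    · exact ha
    · exact hb

/-! ### Maximality -/

theorem IsLMG.addEdge (hG : G.IsLMG) {a b : V} (hab : a ≠ b) (m₁ m₂ : Mark) :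
    (G.addEdge a b m₁ m₂).IsLMG := by
  constructor
  · rintro x y n₁ n₂ (h | ⟨rfl, rfl, rfl, rfl⟩ | ⟨rfl, rfl, rfl, rfl⟩)
    · exact Or.inl (hG.1 _ _ _ _ h)
    · exact Or.inr (Or.inr ⟨rfl, rfl, rfl, rfl⟩)
    · exact Or.inr (Or.inl ⟨rfl, rfl, rfl, rfl⟩)
  · rintro x n₁ n₂ (h | ⟨rfl, h, -⟩ | ⟨rfl, h, -⟩)
    · exact hG.2 _ _ _ h
    · exact hab h
    · exact hab h.symm

theorem BidirInducing.symm (hG : G.IsLMG) {a b : V} (h : G.BidirInducing a b) :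
    G.BidirInducing b a := by
  have h' := transGen_swap.2 h
  refine TransGen.mono (fun u v huv => ?_) _ _ h'
  rw [Set.pair_comm b a]
  exact ⟨hG.1 _ _ _ _ huv.1, huv.2.2, huv.2.1⟩

theorem IsMaximal.not_bidirInducing (hmax : G.IsMaximal) (hG : G.IsAncestral) {a b : V}
    (hab : a ≠ b) (hadj : ¬ G.adj a b) : ¬ G.BidirInducing a b := by
  intro hB
  refine hmax a b hab hadj Mark.arrow Mark.arrow (MarkovEquiv.symm ?_)
  have hBs := hB.symm hG.1
  refine markovEquiv_of_bidirInducing hG.1 (hG.1.addEdge hab _ _) ?_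
    (fun _ _ _ _ h => Or.inl h) ?_
  · rintro d ⟨e, he⟩ c m hc
    have hd : G.selectionAdjacent d := by
      refine ⟨e, ?_⟩
      rcases he with (h | ⟨-, -, h, -⟩ | ⟨-, -, h, -⟩) | (h | ⟨-, -, h, -⟩ | ⟨-, -, h, -⟩)
      · exact Or.inl h
      · cases h
      · cases h
      · exact Or.inr h
      · cases h
      · cases h
    rcases hc with h | ⟨-, rfl, -, -⟩ | ⟨-, rfl, -, -⟩
    · exact hG.2.2.2 d hd c m h
    · obtain ⟨v, hv, -⟩ := hBs.exists_first
      exact hG.2.2.2 _ hd _ _ (hG.1.1 _ _ _ _ hv)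
    · obtain ⟨v, hv, -⟩ := hB.exists_first
      exact hG.2.2.2 _ hd _ _ (hG.1.1 _ _ _ _ hv)
  · rintro x y m₁ m₂ (h | ⟨rfl, rfl, rfl, rfl⟩ | ⟨rfl, rfl, rfl, rfl⟩)
    · exact Or.inl h
    · exact Or.inr ⟨rfl, rfl, hB⟩
    · exact Or.inr ⟨rfl, rfl, hBs⟩

theorem IsAncestral.isMaximal_of_not_bidirInducing (hG : G.IsAncestral)
    (h : ∀ a b, a ≠ b → ¬ G.adj a b → ¬ G.BidirInducing a b) : G.IsMaximal := by
  intro a b hab hadj m₁ m₂ hE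
  refine h a b hab hadj (hG.bidirInducing_of_forall_mConnected hab hadj fun Z ha hb => ?_)
  refine (markovEquiv_iff.1 hE a b Z hab).1 ?_
  exact mConnected_of_edge (hG.1.addEdge hab m₁ m₂) (Or.inr (Or.inl ⟨rfl, rfl, rfl, rfl⟩)) ha hb

theorem IsAncestral.simple (hG : G.IsAncestral) : G.Simple := by
  have key : ∀ {a b m₁ m₂ n₁ n₂}, G.edge a b m₁ m₂ → G.edge a b n₁ n₂ → m₂ = Mark.arrow →
      n₂ = Mark.arrow := by
    rintro a b m₁ m₂ n₁ n₂ h h' rfl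
    by_contra hn
    rw [Mark.eq_tail_of_ne_arrow hn] at h'
    cases n₁ with
    | tail => exact hG.2.2.2 b ⟨a, Or.inr h'⟩ _ _ h
    | arrow => exact hG.not_ancestor_of_arrow h (ReflTransGen.single (hG.1.1 _ _ _ _ h'))
  have key' : ∀ {a b m₁ m₂ n₁ n₂}, G.edge a b m₁ m₂ → G.edge a b n₁ n₂ → m₂ = n₂ := by
    intro a b m₁ m₂ n₁ n₂ h h'
    have h1 := key h h'
    have h2 := key h' h
    cases m₂ <;> cases n₂ <;> simp_all
  intro a b m₁ m₂ n₁ n₂ h h'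
  exact ⟨key' (hG.1.1 _ _ _ _ h) (hG.1.1 _ _ _ _ h'), key' h h'⟩

/-- A maximal extension of an ancestral graph only adds bidirected edges. -/
theorem IsMAGExtension.edge_cases (h : IsMAGExtension G K) (hG : G.IsAncestral) {a b : V}
    {m₁ m₂ : Mark} (he : K.edge a b m₁ m₂) : G.edge a b m₁ m₂ ∨
      (m₁ = Mark.arrow ∧ m₂ = Mark.arrow ∧ G.BidirInducing a b) := by
  obtain ⟨hsub, hK, heq, -⟩ := h
  refine or_iff_not_imp_left.2 fun hnot => ?_
  have hab : a ≠ b := by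
    rintro rfl
    exact hK.1.2 _ _ _ he
  have hadj : ¬ G.adj a b := by
    rintro ⟨n₁, n₂, hn⟩
    obtain ⟨rfl, rfl⟩ := hK.simple _ _ _ _ _ _ (hsub _ _ _ _ hn) he
    exact hnot hn
  have hB : G.BidirInducing a b := hG.bidirInducing_of_forall_mConnected hab hadj fun Z ha hb =>
    (markovEquiv_iff.1 heq a b Z hab).2 (mConnected_of_edge hK.1 he ha hb)
  obtain ⟨u, hu, huA⟩ := hB.exists_first
  obtain ⟨v, hv, hvA⟩ := hB.exists_last
  have hu := hsub _ _ _ _ hu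
  have hv := hsub _ _ _ _ (hG.1.1 _ _ _ _ hv)
  have hpair : ∀ c, c ∈ G.ancSet {a, b} → K.ancestor c a ∨ K.ancestor c b := by
    rintro c ⟨d, rfl | rfl, hcd⟩
    · exact Or.inl (ancestor_mono hsub hcd)
    · exact Or.inr (ancestor_mono hsub hcd)
  have hsela : ¬ K.selectionAdjacent a := fun hs => hK.2.2.2 a hs _ _ (hK.1.1 _ _ _ _ hu)
  refine ⟨?_, ?_, hB⟩
  · cases m₁ with
    | arrow => rfl
    | tail =>
      cases m₂ with
      | tail => exact absurd ⟨b, Or.inl he⟩ hsela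
      | arrow =>
        exact absurd ((hpair v hvA).elim (fun h => h.tail he) id) (hK.not_ancestor_of_arrow hv)
  · cases m₂ with
    | arrow => rfl
    | tail =>
      cases m₁ with
      | tail => exact absurd ⟨b, Or.inl he⟩ hsela
      | arrow =>
        exact absurd ((hpair u huA).elim id fun h => h.tail (hK.1.1 _ _ _ _ he))
          (hK.not_ancestor_of_arrow hu)

end MConnection

section Intervention

variable {V ι : Type} {G K : MixedGraph V} {targets : ι → Set V}

theorem intervention_ancestor_inl {a b : V}
    (h : G.ancestor a b) : (interventionGraph G targets).ancestor (Sum.inl a) (Sum.inl b) :=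
  ReflTransGen.lift Sum.inl (fun _ _ h => h) _ _ h

theorem intervention_dirEdge_target {a b : V ⊕ InterventionIndex targets}
    (h : (interventionGraph G targets).dirEdge a b) : ∃ b', b = Sum.inl b' := by
  rcases a with a | k <;> rcases b with b | l
  · exact ⟨b, rfl⟩
  · cases h.2.1
  · exact ⟨b, rfl⟩
  · exact h.elim

theorem transGen_of_intervention {a : V} {y : V ⊕ InterventionIndex targets}
    (h : TransGen (interventionGraph G targets).dirEdge (Sum.inl a) y) :
    ∃ b, y = Sum.inl b ∧ TransGen G.dirEdge a b := by
  induction h with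
  | @single y h =>
    obtain ⟨b, rfl⟩ := intervention_dirEdge_target h
    exact ⟨b, rfl, TransGen.single h⟩
  | tail _ h ih =>
    obtain ⟨c, rfl, hc⟩ := ih
    obtain ⟨b, rfl⟩ := intervention_dirEdge_target h
    exact ⟨b, rfl, hc.tail h⟩

theorem ancestor_of_intervention {a b : V}
    (h : (interventionGraph G targets).ancestor (Sum.inl a) (Sum.inl b)) : G.ancestor a b := by
  rcases reflTransGen_iff_eq_or_transGen.1 h with h | h
  · rw [Sum.inl.inj h]
    exact ReflTransGen.refl
  · obtain ⟨b', hb', h⟩ := transGen_of_intervention h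
    rw [Sum.inl.inj hb']
    exact h.to_reflTransGen

theorem intervention_bidirEdge {x y : V ⊕ InterventionIndex targets}
    (h : (interventionGraph G targets).bidirEdge x y) :
    ∃ a b, x = Sum.inl a ∧ y = Sum.inl b ∧ G.bidirEdge a b := by
  rcases x with a | k <;> rcases y with b | l
  · exact ⟨a, b, rfl, rfl, h⟩
  · cases h.2.2
  · cases h.2.1
  · exact h.elim

theorem intervention_mem_ancSet_pair {a b c : V} :
    (Sum.inl c : V ⊕ InterventionIndex targets) ∈
      (interventionGraph G targets).ancSet {Sum.inl a, Sum.inl b} ↔ c ∈ G.ancSet {a, b} := by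
  constructor
  · rintro ⟨d, rfl | rfl, h⟩
    · exact ⟨a, by simp, ancestor_of_intervention h⟩
    · exact ⟨b, by simp, ancestor_of_intervention h⟩
  · rintro ⟨d, rfl | rfl, h⟩
    · exact ⟨Sum.inl d, by simp, intervention_ancestor_inl h⟩
    · exact ⟨Sum.inl d, by simp, intervention_ancestor_inl h⟩

theorem BidirInducing.intervention {a b : V} (h : G.BidirInducing a b) :
    (interventionGraph G targets).BidirInducing (Sum.inl a) (Sum.inl b) :=
  TransGen.lift Sum.inl (fun _ _ h => ⟨h.1, intervention_mem_ancSet_pair.2 h.2.1,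
    intervention_mem_ancSet_pair.2 h.2.2⟩) _ _ h

theorem BidirInducing.of_intervention {x y : V ⊕ InterventionIndex targets}
    (h : (interventionGraph G targets).BidirInducing x y) :
    ∃ a b, x = Sum.inl a ∧ y = Sum.inl b ∧ G.BidirInducing a b := by
  obtain ⟨_, hu, -⟩ := h.exists_first
  obtain ⟨_, hv, -⟩ := h.exists_last
  obtain ⟨a, -, rfl, -, -⟩ := intervention_bidirEdge hu
  obtain ⟨-, b, -, rfl, -⟩ := intervention_bidirEdge hv
  refine ⟨a, b, rfl, rfl, ?_⟩
  suffices H : ∀ z, TransGen (fun u v => (interventionGraph G targets).bidirEdge u v ∧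
      u ∈ (interventionGraph G targets).ancSet {Sum.inl a, Sum.inl b} ∧
      v ∈ (interventionGraph G targets).ancSet {Sum.inl a, Sum.inl b}) (Sum.inl a) z →
      ∃ c, z = Sum.inl c ∧ TransGen (fun u v => G.bidirEdge u v ∧ u ∈ G.ancSet {a, b} ∧
        v ∈ G.ancSet {a, b}) a c by
    obtain ⟨c, hc, hac⟩ := H _ h
    rwa [← Sum.inl.inj hc] at hac
  intro z hz
  induction hz with
  | single h =>
    obtain ⟨a', c, ha', rfl, hac⟩ := intervention_bidirEdge h.1
    obtain rfl := Sum.inl.inj ha'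
    exact ⟨c, rfl, TransGen.single ⟨hac, intervention_mem_ancSet_pair.1 h.2.1,
      intervention_mem_ancSet_pair.1 h.2.2⟩⟩
  | tail _ h ih =>
    obtain ⟨d, rfl, hd⟩ := ih
    obtain ⟨d', c, hd', rfl, hdc⟩ := intervention_bidirEdge h.1
    obtain rfl := Sum.inl.inj hd'
    exact ⟨c, rfl, hd.tail ⟨hdc, intervention_mem_ancSet_pair.1 h.2.1,
      intervention_mem_ancSet_pair.1 h.2.2⟩⟩

theorem IsLMG.intervention (hG : G.IsLMG) : (interventionGraph G targets).IsLMG := by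
  constructor
  · rintro (a | k) (b | l) m₁ m₂ h
    · exact hG.1 _ _ _ _ h
    · exact ⟨h.1, h.2.2, h.2.1⟩
    · exact ⟨h.1, h.2.2, h.2.1⟩
    · exact h
  · rintro (a | k) m₁ m₂ h
    · exact hG.2 _ _ _ h
    · exact h

theorem Subgraph.intervention (h : Subgraph G K) :
    Subgraph (interventionGraph G targets) (interventionGraph K targets) := by
  rintro (a | k) (b | l) m₁ m₂ he
  · exact h _ _ _ _ he
  · exact he
  · exact he
  · exact he

theorem IsAncestral.intervention (hG : G.IsAncestral)
    (hsel : ∀ i, G.selectionAdjacent i → ∀ k, i ∉ targets k) :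
    (interventionGraph G targets).IsAncestral := by
  refine ⟨hG.1.intervention, ?_, ?_, ?_⟩
  · intro x hx
    obtain ⟨y, -, hy⟩ := TransGen.tail'_iff.1 hx
    obtain ⟨a, rfl⟩ := intervention_dirEdge_target hy
    obtain ⟨b, hb, hab⟩ := transGen_of_intervention hx
    rw [← Sum.inl.inj hb] at hab
    exact hG.2.1 a hab
  · intro x y hxy
    obtain ⟨a, b, rfl, rfl, hab⟩ := intervention_bidirEdge hxy
    refine ⟨fun h => ?_, fun h => ?_⟩
    · obtain ⟨b', hb', h⟩ := transGen_of_intervention h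
      rw [← Sum.inl.inj hb'] at h
      exact (hG.2.2.1 a b hab).1 h
    · obtain ⟨b', hb', h⟩ := transGen_of_intervention h
      rw [← Sum.inl.inj hb'] at h
      exact (hG.2.2.1 a b hab).2 h
  · have hundir : ∀ x y, (interventionGraph G targets).undirEdge x y →
        ∃ a b, x = Sum.inl a ∧ y = Sum.inl b ∧ G.undirEdge a b := by
      rintro (a | k) (b | l) h
      · exact ⟨a, b, rfl, rfl, h⟩
      · cases h.2.1
      · cases h.2.2
      · exact h.elim
    rintro x ⟨y, hy⟩ z m hz
    obtain ⟨a, rfl, ha⟩ : ∃ a, x = Sum.inl a ∧ G.selectionAdjacent a := by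
      rcases hy with h | h
      · obtain ⟨a, b, rfl, rfl, hab⟩ := hundir _ _ h
        exact ⟨a, rfl, b, Or.inl hab⟩
      · obtain ⟨b, a, rfl, rfl, hab⟩ := hundir _ _ h
        exact ⟨a, rfl, b, Or.inr hab⟩
    rcases z with b | k
    · exact hG.2.2.2 a ha b m hz
    · exact hsel a ha k.1 hz.1

theorem IsMaximal.intervention (hmax : G.IsMaximal) (hG : G.IsAncestral)
    (hGI : (interventionGraph G targets).IsAncestral) :
    (interventionGraph G targets).IsMaximal := by
  refine hGI.isMaximal_of_not_bidirInducing fun x y hxy hadj hB => ?_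
  obtain ⟨a, b, rfl, rfl, hab⟩ := hB.of_intervention
  exact hmax.not_bidirInducing hG (fun h => hxy (congrArg Sum.inl h)) hadj hab

theorem IsMAGExtension.selectionAdjacent (h : IsMAGExtension G K) (hG : G.IsAncestral) {a : V}
    (ha : K.selectionAdjacent a) : G.selectionAdjacent a := by
  have hu : ∀ {c d}, K.undirEdge c d → G.undirEdge c d := fun hcd =>
    (h.edge_cases hG hcd).resolve_right fun h => by cases h.1
  obtain ⟨b, hb⟩ := ha
  exact ⟨b, hb.imp hu hu⟩

theorem IsMAGExtension.intervention_markovEquiv (h : IsMAGExtension G K) (hG : G.IsAncestral)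
    (hKI : (interventionGraph K targets).IsAncestral) :
    MarkovEquiv (interventionGraph G targets) (interventionGraph K targets) := by
  refine markovEquiv_of_bidirInducing hG.1.intervention hKI.1 hKI.2.2.2 h.1.intervention ?_
  rintro (a | k) (b | l) m₁ m₂ he
  · exact (h.edge_cases hG he).imp id fun h => ⟨h.1, h.2.1, h.2.2.intervention⟩
  · exact Or.inl he
  · exact Or.inl he
  · exact Or.inl he

end Intervention

end MixedGraph

/-- Special case of the main theorem. Let `G`, `H` be ancestral graphs
on `[p]` and `𝓘` a multiset of intervention targets such that no selection adjacent node
of `G` or of `H` is intervened on by any target in `𝓘`. Then `G` and `H` are `𝓘`-Markov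
equivalent iff `Ḡ^𝓘` and `H̄^𝓘` are Markov equivalent maximal ancestral graphs. -/
theorem stmt16 {p : ℕ} {ι : Type} [Fintype ι] (G H : MixedGraph (Fin p))
    (hG : G.IsAncestral) (hH : H.IsAncestral) (targets : ι → Set (Fin p))
    (hsel : ∀ i, (G.selectionAdjacent i ∨ H.selectionAdjacent i) → ∀ k, i ∉ targets k)
    (Gbar Hbar : MixedGraph (Fin p))
    (hGbar : MixedGraph.IsMAGExtension G Gbar) (hHbar : MixedGraph.IsMAGExtension H Hbar) :
    IMarkovEquiv G H targets ↔
      ((interventionGraph Gbar targets).IsAncestral ∧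
        (interventionGraph Gbar targets).IsMaximal ∧
        (interventionGraph Hbar targets).IsAncestral ∧
        (interventionGraph Hbar targets).IsMaximal ∧
        MixedGraph.MarkovEquiv (interventionGraph Gbar targets)
          (interventionGraph Hbar targets)) := by
  have hGI : (interventionGraph Gbar targets).IsAncestral := hGbar.2.1.intervention
    fun i hi => hsel i (Or.inl (hGbar.selectionAdjacent hG hi))
  have hHI : (interventionGraph Hbar targets).IsAncestral := hHbar.2.1.intervention
    fun i hi => hsel i (Or.inr (hHbar.selectionAdjacent hH hi))
  have hGE := hGbar.intervention_markovEquiv hG hGI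
  have hHE := hHbar.intervention_markovEquiv hH hHI
  constructor
  · intro h
    exact ⟨hGI, hGbar.2.2.2.intervention hGbar.2.1 hGI, hHI,
      hHbar.2.2.2.intervention hHbar.2.1 hHI, (hGE.symm.trans h).trans hHE⟩
  · rintro ⟨-, -, -, -, h⟩
    exact (hGE.trans h).trans hHE.symm
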